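/- Almost everywhere convergence of the Bernstein–Durrmeyer operators (Proposition 4.11, classical simplex weight): for f ∈ L^1(T^d, W_κ^T dx) define M_n^T(f;x) = Σ_{α ∈ ℕ_0^d, |α| ≤ n} [∫_{T^d} f(y) B_α(y) W_κ^T(y) dy / ∫_{T^d} B_α(y) W_κ^T(y) dy] B_α(x), where for |α| ≤ n, B_α(x) = (n! / (α_1! ⋯ α_d! (n-|α|)!)) x_1^{α_1} ⋯ x_d^{α_d} (1-|x|)^{n-|α|} is the Bernstein basis polynomial of degree n. Then lim_{n→∞} M_n^T(f;x) = f(x) for almost every x ∈ T^d. -/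

import Mathlib

open MeasureTheory Real Filter Set

noncomputable section

/-- The standard simplex `T^d = {x : xᵢ ≥ 0, x₁+…+x_d ≤ 1}`. -/
def simplexT (d : ℕ) : Set (EuclideanSpace ℝ (Fin d)) :=
  {x | (∀ i, 0 ≤ x i) ∧ ∑ i, x i ≤ 1}

/-- The classical Jacobi weight
`W_κ^T(x) = x₁^{κ₁-1/2} ⋯ x_d^{κ_d-1/2} (1-|x|)^{κ_{d+1}-1/2}` on `T^d`. -/
def WTJ {d : ℕ} (κ : Fin (d+1) → ℝ) (x : EuclideanSpace ℝ (Fin d)) : ℝ :=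
  (∏ i : Fin d, x i ^ (κ i.castSucc - 1/2)) * (1 - ∑ i, x i) ^ (κ (Fin.last d) - 1/2)

/-- The Bernstein basis polynomial
`B_α(x) = (n!/(α₁!⋯α_d!(n-|α|)!)) x₁^{α₁}⋯x_d^{α_d}(1-|x|)^{n-|α|}`. -/
def bernsteinB {d : ℕ} (n : ℕ) (α : Fin d → ℕ) (x : EuclideanSpace ℝ (Fin d)) : ℝ :=
  ((n.factorial : ℝ) / ((∏ i, (α i).factorial : ℕ) * (n - ∑ i, α i).factorial)) *
    (∏ i, x i ^ α i) * (1 - ∑ i, x i) ^ (n - ∑ i, α i)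

/-- The Bernstein–Durrmeyer operator `M_n^T(f;x)`, summing over all
`α ∈ ℕ₀^d` with `|α| ≤ n` (such `α` satisfy `αᵢ ≤ n`, so they are
enumerated by `β : Fin d → Fin (n+1)`). -/
def bernsteinDurrmeyer (d : ℕ) (κ : Fin (d+1) → ℝ)
    (f : EuclideanSpace ℝ (Fin d) → ℝ) (n : ℕ) (x : EuclideanSpace ℝ (Fin d)) : ℝ :=
  ∑ β : Fin d → Fin (n+1),
    if (∑ i, (β i : ℕ)) ≤ n then
      ((∫ y in simplexT d, f y * bernsteinB n (fun i => (β i : ℕ)) y * WTJ κ y) /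
          ∫ y in simplexT d, bernsteinB n (fun i => (β i : ℕ)) y * WTJ κ y) *
        bernsteinB n (fun i => (β i : ℕ)) x
    else 0


lemma multi_sum {d : ℕ} (n : ℕ) (z : Fin d → ℝ) (z0 : ℝ) :
    (∑ β : Fin d → Fin (n+1), if (∑ i, (β i : ℕ)) ≤ n then
      ((n.factorial : ℝ) / ((∏ i, ((β i : ℕ)).factorial : ℕ) * (n - ∑ i, (β i : ℕ)).factorial)) *
    (∏ i, z i ^ (β i : ℕ)) * z0 ^ (n - ∑ i, (β i : ℕ)) else 0) = (∑ i, z i + z0) ^ n := by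
  have h := Finset.sum_pow_eq_sum_piAntidiag (Finset.univ : Finset (Fin (d+1)))
    (Fin.snoc (α := fun _ => ℝ) z z0) n
  rw [Fin.sum_univ_castSucc] at h
  simp only [Fin.snoc_castSucc, Fin.snoc_last] at h
  rw [h, ← Finset.sum_filter]
  refine Finset.sum_bij
    (fun β _ => Fin.snoc (α := fun _ => ℕ) (fun i => (β i : ℕ)) (n - ∑ i, (β i : ℕ))) ?_ ?_ ?_ ?_
  · intro β hβ
    simp only [Finset.mem_filter, Finset.mem_univ, true_and] at hβ
    simp only [Finset.mem_piAntidiag, Fin.sum_univ_castSucc, Fin.snoc_castSucc, Fin.snoc_last]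
    refine ⟨by omega, by simp⟩
  · intro β _ γ _ hβγ
    funext i
    have := congrFun hβγ i.castSucc
    simp only [Fin.snoc_castSucc] at this
    exact Fin.ext this
  · intro k hk
    simp only [Finset.mem_piAntidiag, Fin.sum_univ_castSucc] at hk
    have hle : ∀ i : Fin d, k i.castSucc ≤ ∑ j : Fin d, k j.castSucc := fun i =>
      Finset.single_le_sum (f := fun j : Fin d => k j.castSucc) (fun _ _ => Nat.zero_le _)
        (Finset.mem_univ i)
    refine ⟨fun i => ⟨k i.castSucc, by have := hle i; omega⟩, ?_, ?_⟩
    · simp only [Finset.mem_filter, Finset.mem_univ, true_and]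
      omega
    · funext i
      refine Fin.lastCases ?_ (fun j => ?_) i
      · simp only [Fin.snoc_last]; omega
      · simp only [Fin.snoc_castSucc]
  · intro β hβ
    simp only [Finset.mem_filter, Finset.mem_univ, true_and] at hβ
    have hs := Nat.multinomial_spec (Finset.univ : Finset (Fin (d+1)))
      (Fin.snoc (α := fun _ => ℕ) (fun i => (β i : ℕ)) (n - ∑ i, (β i : ℕ)))
    simp only [Fin.prod_univ_castSucc, Fin.sum_univ_castSucc, Fin.snoc_castSucc, Fin.snoc_last] at hs ⊢
    rw [Nat.add_sub_cancel' hβ] at hs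
    rw [← mul_assoc]
    congr 2
    rw [← hs]
    have h1 : ((∏ i, ((β i : ℕ)).factorial : ℕ) : ℝ) ≠ 0 := by
      exact_mod_cast Finset.prod_ne_zero_iff.2 fun i _ => Nat.factorial_ne_zero _
    have h2 : (((n - ∑ i, (β i : ℕ)).factorial : ℕ) : ℝ) ≠ 0 := by
      exact_mod_cast Nat.factorial_ne_zero _
    push_cast at h1 ⊢
    field_simp

/-- partition of unity -/
lemma bern_sum {d : ℕ} (n : ℕ) (x : EuclideanSpace ℝ (Fin d)) :
    (∑ β : Fin d → Fin (n+1), if (∑ i, (β i : ℕ)) ≤ n then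
      bernsteinB n (fun i => (β i : ℕ)) x else 0) = 1 := by
  have := multi_sum n (fun i => x i) (1 - ∑ i, x i)
  simp only [bernsteinB]
  rw [this]; simp

lemma bern_nonneg {d : ℕ} (n : ℕ) (α : Fin d → ℕ) {y : EuclideanSpace ℝ (Fin d)}
    (hy : y ∈ simplexT d) : 0 ≤ bernsteinB n α y := by
  unfold bernsteinB
  have h1 : 0 ≤ ∏ i, y i ^ α i := Finset.prod_nonneg fun i _ => pow_nonneg (hy.1 i) _
  have h2 : 0 ≤ 1 - ∑ i, y i := by linarith [hy.2]
  positivity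

lemma mgf_sum {d : ℕ} (n : ℕ) {y : EuclideanSpace ℝ (Fin d)} (hy : y ∈ simplexT d) (j : Fin d)
    (θ : ℝ) (hθ : |θ| ≤ 1) :
    (∑ β : Fin d → Fin (n+1), if (∑ i, (β i : ℕ)) ≤ n then
      Real.exp (θ * (β j : ℕ)) * bernsteinB n (fun i => (β i : ℕ)) y else 0)
      ≤ Real.exp (n * (θ * y j + θ^2)) := by
  have h := multi_sum n (fun i => y i * (if i = j then Real.exp θ else 1)) (1 - ∑ i, y i)
  have e1 : (∑ i, y i * (if i = j then Real.exp θ else 1)) + (1 - ∑ i, y i)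
      = 1 + y j * (Real.exp θ - 1) := by
    have : ∀ i, y i * (if i = j then Real.exp θ else 1)
        = y i + (if i = j then y i * (Real.exp θ - 1) else 0) := by
      intro i; split_ifs <;> ring
    simp only [this, Finset.sum_add_distrib, Finset.sum_ite_eq', Finset.mem_univ, if_true]
    ring
  rw [e1] at h
  have hyj0 := hy.1 j
  have hyj1 : y j ≤ 1 := le_trans
    (Finset.single_le_sum (f := fun i => y i) (fun i _ => hy.1 i) (Finset.mem_univ j)) hy.2
  calc _ = (1 + y j * (Real.exp θ - 1))^n := by
        rw [← h]
        refine Finset.sum_congr rfl fun β _ => ?_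
        split_ifs
        · unfold bernsteinB
          have : (∏ i, (y i * (if i = j then Real.exp θ else 1)) ^ (β i : ℕ))
            = (∏ i, y i ^ (β i : ℕ)) * Real.exp (θ * (β j : ℕ)) := by
            simp only [mul_pow, Finset.prod_mul_distrib]
            congr 1
            rw [Finset.prod_eq_single j]
            · simp [← Real.exp_nat_mul, mul_comm]
            · intro b _ hb; simp [hb]
            · simp
          rw [this]; ring
        · rfl
    _ ≤ (Real.exp (θ * y j + θ^2))^n := by
        have hb := (abs_le.1 (Real.abs_exp_sub_one_sub_id_le hθ)).2
        have hpos := Real.exp_pos θ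
        apply pow_le_pow_left₀
        · nlinarith
        · refine le_trans ?_ (Real.add_one_le_exp _)
          nlinarith [sq_nonneg θ]
    _ = _ := by rw [← Real.exp_nat_mul]

lemma kernel_tail {d : ℕ} (n : ℕ) (hn : 1 ≤ n) {x y : EuclideanSpace ℝ (Fin d)}
    (hx : x ∈ simplexT d) (hy : y ∈ simplexT d) (hd : 1 ≤ d) :
    (∑ β : Fin d → Fin (n+1), if (∑ i, (β i : ℕ)) ≤ n then
      Real.exp (-(n / 8) * ∑ i, (x i - (β i : ℕ) / n)^2) * bernsteinB n (fun i => (β i : ℕ)) y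
      else 0)
      ≤ Real.exp (-(1 / (16 * d)) * n * ‖x - y‖^2) := by
  have hn0 : (0:ℝ) < n := by exact_mod_cast hn
  have hd0 : (0:ℝ) < d := by exact_mod_cast hd
  have : Nonempty (Fin d) := ⟨⟨0, hd⟩⟩
  obtain ⟨j, hj⟩ := Finite.exists_max (fun i => (x i - y i)^2)
  have hnorm : ‖x - y‖^2 ≤ d * (x j - y j)^2 := by
    rw [EuclideanSpace.norm_sq_eq]
    calc _ ≤ ∑ i : Fin d, (x j - y j)^2 := Finset.sum_le_sum fun i _ => by
            simpa using hj i
      _ = _ := by simp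
  have le1 : ∀ {z : EuclideanSpace ℝ (Fin d)}, z ∈ simplexT d → z j ≤ 1 := fun {z} hz => le_trans
    (Finset.single_le_sum (f := fun i => z i) (fun i _ => hz.1 i) (Finset.mem_univ j)) hz.2
  set a := x j - y j with ha
  have habs : |a| ≤ 1 := by
    rw [abs_le]; constructor <;> linarith [le1 hx, le1 hy, hx.1 j, hy.1 j]
  have hm := mgf_sum n hy j (a / 4) (by rw [abs_div]; norm_num; linarith)
  calc _ ≤ ∑ β : Fin d → Fin (n+1), Real.exp (n/8 * (a^2 - 2 * a * x j)) *
        (if (∑ i, (β i : ℕ)) ≤ n then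
          Real.exp (a / 4 * (β j : ℕ)) * bernsteinB n (fun i => (β i : ℕ)) y else 0) := by
        refine Finset.sum_le_sum fun β _ => ?_
        split_ifs
        · rw [← mul_assoc, ← Real.exp_add]
          refine mul_le_mul_of_nonneg_right (Real.exp_le_exp.2 ?_) (bern_nonneg _ _ hy)
          have h1 : (x j - (β j : ℕ) / n)^2 ≤ ∑ i, (x i - (β i : ℕ) / n)^2 :=
            Finset.single_le_sum (f := fun i => (x i - ((β i : ℕ) : ℝ) / n)^2)
              (fun i _ => sq_nonneg _) (Finset.mem_univ j)
          have h2 : -(x j - ((β j : ℕ) : ℝ) / n)^2 ≤ a^2 - 2 * a * (x j - (β j : ℕ) / n) := by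
            nlinarith [sq_nonneg (a - (x j - ((β j : ℕ) : ℝ) / n))]
          have h3 : (n/8 : ℝ) * (a^2 - 2 * a * (x j - (β j : ℕ) / n))
              = n/8 * (a^2 - 2 * a * x j) + a / 4 * (β j : ℕ) := by
            field_simp; ring
          rw [← h3]
          nlinarith
        · simp
    _ ≤ Real.exp (n/8 * (a^2 - 2 * a * x j)) * Real.exp (n * (a / 4 * y j + (a / 4)^2)) := by
        rw [← Finset.mul_sum]
        exact mul_le_mul_of_nonneg_left hm (Real.exp_pos _).le
    _ = Real.exp (-(n / 16) * a^2) := by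
        rw [← Real.exp_add, ha]; congr 1; ring
    _ ≤ _ := by
        apply Real.exp_le_exp.2
        have : (n : ℝ) / (16 * d) * ‖x - y‖^2 ≤ n / (16 * d) * (d * a^2) :=
          mul_le_mul_of_nonneg_left hnorm (by positivity)
        have e : (n : ℝ) / (16 * d) * (d * a^2) = n / 16 * a^2 := by field_simp
        rw [e] at this
        have e2 : -(1 / (16 * (d:ℝ))) * n * ‖x - y‖^2 = -((n : ℝ) / (16 * d) * ‖x - y‖^2) := by ring
        rw [e2]; linarith

def phiL {d : ℕ} (j : Fin d) : (Fin d → ℝ) →ₗ[ℝ] (Fin d → ℝ) where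
  toFun x := fun i => if i = j then -∑ k, x k else x i
  map_add' x y := by
    funext i; simp only [Pi.add_apply, Finset.sum_add_distrib]; split_ifs <;> ring
  map_smul' c x := by
    funext i; simp only [Pi.smul_apply, smul_eq_mul, ← Finset.mul_sum, RingHom.id_apply]
    split_ifs <;> ring

lemma phiL_invol {d : ℕ} (j : Fin d) : (phiL j).comp (phiL j) = LinearMap.id := by
  ext1 k
  ext x
  simp only [phiL, LinearMap.comp_apply, LinearMap.coe_mk, AddHom.coe_mk, LinearMap.id_apply]
  set v : Fin d → ℝ := (LinearMap.single ℝ (fun _ => ℝ) k) 1 with hv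
  by_cases h : x = j
  · subst h
    simp only [if_true]
    rw [← Finset.sum_erase_add _ _ (Finset.mem_univ x)]
    have h1 : ∑ i ∈ Finset.univ.erase x, (if i = x then -∑ k, v k else v i)
        = ∑ i ∈ Finset.univ.erase x, v i :=
      Finset.sum_congr rfl fun i hi => by rw [if_neg (Finset.ne_of_mem_erase hi)]
    have h2 := Finset.sum_erase_add Finset.univ v (Finset.mem_univ x)
    rw [h1]; simp only [if_true]; linarith
  · simp [h]

lemma phi_mp {d : ℕ} (j : Fin d) :
    MeasurePreserving (fun x : Fin d → ℝ => fun i => if i = j then 1 - ∑ k, x k else x i)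
      volume volume := by
  have hdet : LinearMap.det (phiL j) * LinearMap.det (phiL j) = 1 := by
    rw [← LinearMap.det_comp, phiL_invol, LinearMap.det_id]
  have hne : LinearMap.det (phiL j) ≠ 0 := by
    intro h; rw [h] at hdet; simp at hdet
  have habs : |(LinearMap.det (phiL j))⁻¹| = 1 := by
    rcases mul_self_eq_one_iff.1 hdet with h | h <;> rw [h] <;> simp
  have h1 : MeasurePreserving (phiL j) volume volume := by
    refine ⟨(LinearMap.continuous_of_finiteDimensional _).measurable, ?_⟩
    rw [Measure.map_linearMap_addHaar_eq_smul_addHaar _ hne, habs]; simp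
  have h2 := (measurePreserving_add_right (volume : Measure (Fin d → ℝ))
    (fun i => if i = j then (1:ℝ) else 0)).comp h1
  convert h2 using 1
  funext x i
  simp only [phiL, LinearMap.coe_mk, AddHom.coe_mk, Function.comp, Pi.add_apply]
  split_ifs <;> ring

def hh (t : ℝ) : ℝ := indicator (Ioc 0 1) (fun t => t ^ (-(1/2) : ℝ)) t

lemma hh_nonneg (t : ℝ) : 0 ≤ hh t := by
  unfold hh
  exact Set.indicator_nonneg (fun t ht => Real.rpow_nonneg ht.1.le _) t

lemma hh_int : Integrable hh := by
  unfold hh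
  rw [integrable_indicator_iff measurableSet_Ioc]
  have := intervalIntegral.intervalIntegrable_rpow' (a := 0) (b := 1) (r := -(1/2)) (by norm_num)
  rwa [intervalIntegrable_iff_integrableOn_Ioc_of_le zero_le_one] at this

lemma simplex_meas (d : ℕ) : MeasurableSet (simplexT d) := by
  have : IsClosed (simplexT d) := by
    have h1 : simplexT d = (⋂ i, {x | 0 ≤ x i}) ∩ {x | ∑ i, x i ≤ 1} := by
      ext x; simp [simplexT]
    rw [h1]
    refine IsClosed.inter (isClosed_iInter fun i => isClosed_le (by fun_prop) (by fun_prop)) ?_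
    exact isClosed_le (by fun_prop) (by fun_prop)
  exact this.measurableSet

lemma WTJ_meas {d : ℕ} (κ : Fin (d+1) → ℝ) : Measurable (WTJ κ) := by
  unfold WTJ
  refine Measurable.mul (Finset.measurable_prod _ fun i _ => ?_) ?_
  · exact Measurable.pow_const (by fun_prop) _
  · exact Measurable.pow_const (by fun_prop) _

lemma ae_pos (d : ℕ) (hd : 1 ≤ d) : ∀ᵐ x ∂(volume.restrict (simplexT d)),
    (∀ i, 0 < x i) ∧ ∑ i, x i < 1 := by
  have h1 : ∀ i : Fin d, ∀ᵐ x : Fin d → ℝ, x i ≠ 0 := by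
    intro i
    have := Measure.pi_hyperplane (fun _ : Fin d => (volume : Measure ℝ)) i 0
    rw [ae_iff, volume_pi]; simpa using this
  have h1' : ∀ᵐ x : Fin d → ℝ, ∀ i, x i ≠ 0 := ae_all_iff.2 h1
  have h2 : ∀ᵐ x : Fin d → ℝ, 1 - ∑ i, x i ≠ 0 := by
    have := (phi_mp (⟨0, hd⟩ : Fin d)).quasiMeasurePreserving.ae (h1 ⟨0, hd⟩)
    simpa using this
  have h3 := (PiLp.volume_preserving_ofLp (Fin d)).quasiMeasurePreserving.ae (h1'.and h2)
  rw [ae_restrict_iff' (simplex_meas d)]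
  filter_upwards [h3] with x hx hxT
  refine ⟨fun i => lt_of_le_of_ne (hxT.1 i) (Ne.symm (hx.1 i)), lt_of_le_of_ne hxT.2 ?_⟩
  intro h; exact hx.2 (by rw [h]; ring)

lemma rpow_le_hh {t e : ℝ} (h0 : 0 < t) (h1 : t ≤ 1) (he : -(1/2) ≤ e) : t ^ e ≤ hh t := by
  unfold hh
  rw [Set.indicator_of_mem (show t ∈ Ioc 0 1 from ⟨h0, h1⟩)]
  exact Real.rpow_le_rpow_of_exponent_ge h0 h1 he

lemma hh_le {t : ℝ} {m : ℝ} (hm : 1 ≤ m) (h0 : 1 / m ≤ t) : hh t ≤ m := by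
  have hm0 : 0 < m := by linarith
  have ht : 0 < t := lt_of_lt_of_le (by positivity) h0
  unfold hh
  refine Set.indicator_apply_le' (fun h => ?_) (fun _ => hm0.le)
  calc t ^ (-(1/2) : ℝ) ≤ t ^ (-1 : ℝ) :=
        Real.rpow_le_rpow_of_exponent_ge ht h.2 (by norm_num)
    _ = 1 / t := by rw [Real.rpow_neg_one]; simp
    _ ≤ m := by rw [div_le_iff₀ ht]; rw [div_le_iff₀ hm0] at h0; linarith

lemma WTJ_nonneg {d : ℕ} (κ : Fin (d+1) → ℝ) {y : EuclideanSpace ℝ (Fin d)}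
    (hy : y ∈ simplexT d) : 0 ≤ WTJ κ y := by
  unfold WTJ
  exact mul_nonneg (Finset.prod_nonneg fun i _ => Real.rpow_nonneg (hy.1 i) _)
    (Real.rpow_nonneg (by linarith [hy.2]) _)

lemma WTJ_int {d : ℕ} (hd : 1 ≤ d) (κ : Fin (d+1) → ℝ) (hκ : ∀ i, 0 < κ i) :
    IntegrableOn (WTJ κ) (simplexT d) := by
  have hP : Integrable (fun x : Fin d → ℝ => ∏ i, hh (x i)) :=
    Integrable.fintype_prod (fun _ => hh_int)
  have hQ : ∀ j : Fin d, Integrable (fun x : Fin d → ℝ => ∏ i, hh (if i = j then 1 - ∑ k, x k else x i)) :=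
    fun j => (phi_mp j).integrable_comp_of_integrable hP
  have hS : Integrable (fun x : Fin d → ℝ => ((d : ℝ) + 1) * (∏ i, hh (x i) +
      ∑ j, ∏ i, hh (if i = j then 1 - ∑ k, x k else x i))) :=
    (hP.add (integrable_finsetSum _ fun j _ => hQ j)).const_mul _
  have hS' := (PiLp.volume_preserving_ofLp (Fin d)).integrable_comp_of_integrable hS
  refine Integrable.mono' hS'.integrableOn (WTJ_meas κ).aestronglyMeasurable ?_
  filter_upwards [ae_pos d hd, ae_restrict_mem (simplex_meas d)] with x hx hxT
  rw [Real.norm_of_nonneg (WTJ_nonneg κ hxT)]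
  simp only [Function.comp]
  have hd1 : (1:ℝ) ≤ (d:ℝ) + 1 := by linarith [(Nat.cast_nonneg d : (0:ℝ) ≤ d)]
  have hle1 : ∀ i, x i ≤ 1 := fun i => le_trans
    (Finset.single_le_sum (f := fun i => x i) (fun i _ => hxT.1 i) (Finset.mem_univ i)) hxT.2
  have hprod0 : ∀ v : Fin d → ℝ, 0 ≤ ∏ i, hh (v i) := fun v =>
    Finset.prod_nonneg fun i _ => hh_nonneg _
  have hW : WTJ κ x ≤ (∏ i, hh (x i)) * hh (1 - ∑ i, x i) := by
    unfold WTJ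
    refine mul_le_mul ?_ ?_ (Real.rpow_nonneg (by linarith [hx.2]) _) (hprod0 _)
    · exact Finset.prod_le_prod (fun i _ => Real.rpow_nonneg (hxT.1 i) _)
        (fun i _ => rpow_le_hh (hx.1 i) (hle1 i) (by linarith [hκ i.castSucc]))
    · exact rpow_le_hh (by linarith [hx.2])
        (by linarith [Finset.sum_nonneg (fun i (_ : i ∈ Finset.univ) => hxT.1 i)])
        (by linarith [hκ (Fin.last d)])
  refine hW.trans ?_
  by_cases hc : 1 / ((d:ℝ) + 1) ≤ 1 - ∑ i, x i
  · rw [mul_comm]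
    refine mul_le_mul (hh_le hd1 hc) ?_ (hprod0 _) (by linarith)
    linarith [Finset.sum_nonneg (fun j (_ : j ∈ (Finset.univ : Finset (Fin d))) =>
      hprod0 (fun i => if i = j then 1 - ∑ k, x k else x i))]
  · obtain ⟨j, hj⟩ : ∃ j, 1 / ((d:ℝ) + 1) ≤ x j := by
      by_contra! hcon
      have : ∑ i, x i ≤ ∑ i : Fin d, 1 / ((d:ℝ) + 1) := Finset.sum_le_sum fun i _ => (hcon i).le
      simp only [Finset.sum_const, Finset.card_univ, Fintype.card_fin, nsmul_eq_mul] at this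
      apply hc
      have e : (d:ℝ) * (1 / ((d:ℝ)+1)) = 1 - 1 / ((d:ℝ)+1) := by field_simp; ring
      linarith
    have e : (∏ i, hh (x i)) * hh (1 - ∑ i, x i)
        = hh (x j) * ∏ i, hh (if i = j then 1 - ∑ k, x k else x i) := by
      rw [← Finset.mul_prod_erase _ _ (Finset.mem_univ j),
        ← Finset.mul_prod_erase (a := j) _ (fun i => hh (if i = j then 1 - ∑ k, x k else x i))
          (Finset.mem_univ j)]
      have : ∏ i ∈ Finset.univ.erase j, hh (if i = j then 1 - ∑ k, x k else x i)
          = ∏ i ∈ Finset.univ.erase j, hh (x i) :=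
        Finset.prod_congr rfl fun i hi => by rw [if_neg (Finset.ne_of_mem_erase hi)]
      rw [this]; simp only [if_true]; ring
    rw [e]
    refine mul_le_mul (hh_le hd1 hj) ?_ (hprod0 _) (by linarith)
    have := Finset.single_le_sum (f := fun j => ∏ i, hh (if i = j then 1 - ∑ k, x k else x i))
      (fun j _ => hprod0 (fun i => if i = j then 1 - ∑ k, x k else x i)) (Finset.mem_univ j)
    have h0 := hprod0 (fun i => x i)
    simp only at this
    linarith

lemma prod_upper {ι : Type*} [Fintype ι] (n : ℕ) (hn : 1 ≤ n) (a : ι → ℕ) (x : ι → ℝ)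
    (hx : ∀ i, 0 < x i) (ha : ∑ i, a i = n) (hx1 : ∑ i, x i = 1) :
    ∏ i, x i ^ a i ≤ (∏ i, ((a i : ℝ) / n) ^ a i) * Real.exp (-(n/4) * ∑ i, (x i - a i / n)^2) := by
  have hn0 : (0:ℝ) < n := by exact_mod_cast hn
  have hp1 : ∑ i, ((a i : ℝ) / n) = 1 := by
    rw [← Finset.sum_div, ← Nat.cast_sum, ha, div_self hn0.ne']
  have hp0 : ∀ i, 0 ≤ (a i : ℝ) / n := fun i => by positivity
  have hx' : ∀ i, x i ≤ 1 := fun i => by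
    rw [← hx1]; exact Finset.single_le_sum (fun i _ => (hx i).le) (Finset.mem_univ i)
  have hp' : ∀ i, (a i : ℝ) / n ≤ 1 := fun i => by
    rw [← hp1]
    exact Finset.single_le_sum (f := fun i => (a i : ℝ) / n) (fun i _ => hp0 i) (Finset.mem_univ i)
  have key : ∀ i, x i ^ a i ≤ ((a i : ℝ) / n) ^ a i *
      Real.exp (2 * n * (√((a i : ℝ) / n) * √(x i) - a i / n)) := by
    intro i
    rcases Nat.eq_zero_or_pos (a i) with h | h
    · simp [h]
    have hai : (0:ℝ) < a i := by exact_mod_cast h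
    have hp : 0 < (a i : ℝ) / n := by positivity
    have hsp : 0 < √((a i : ℝ) / n) := Real.sqrt_pos.2 hp
    have h1 : √(x i) / √((a i : ℝ) / n) ≤ Real.exp (√(x i) / √((a i : ℝ) / n) - 1) := by
      have := Real.add_one_le_exp (√(x i) / √((a i : ℝ) / n) - 1); linarith
    have h2 : x i ≤ (a i : ℝ) / n * Real.exp (2 * (√(x i) / √((a i : ℝ) / n) - 1)) := by
      have := pow_le_pow_left₀ (by positivity) h1 2
      rw [div_pow, Real.sq_sqrt (hx i).le, Real.sq_sqrt hp.le, div_le_iff₀ hp,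
        ← Real.exp_nat_mul] at this
      rw [mul_comm]; exact_mod_cast this
    refine (pow_le_pow_left₀ (hx i).le h2 (a i)).trans (le_of_eq ?_)
    rw [mul_pow, ← Real.exp_nat_mul]
    congr 2
    have e : (a i : ℝ) / √((a i : ℝ) / n) = n * √((a i : ℝ) / n) := by
      rw [div_eq_iff hsp.ne', mul_assoc, Real.mul_self_sqrt hp.le]; field_simp
    calc (a i : ℝ) * (2 * (√(x i) / √((a i : ℝ) / n) - 1))
        = 2 * ((a i : ℝ) / √((a i : ℝ) / n)) * √(x i) - 2 * a i := by ring
      _ = _ := by rw [e]; field_simp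
  calc ∏ i, x i ^ a i ≤ ∏ i, (((a i : ℝ) / n) ^ a i *
      Real.exp (2 * n * (√((a i : ℝ) / n) * √(x i) - a i / n))) :=
        Finset.prod_le_prod (fun i _ => pow_nonneg (hx i).le _) fun i _ => key i
    _ = (∏ i, ((a i : ℝ) / n) ^ a i) *
        Real.exp (∑ i, 2 * n * (√((a i : ℝ) / n) * √(x i) - a i / n)) := by
        rw [Finset.prod_mul_distrib, Real.exp_sum]
    _ ≤ _ := by
        refine mul_le_mul_of_nonneg_left (Real.exp_le_exp.2 ?_)
          (Finset.prod_nonneg fun i _ => pow_nonneg (hp0 i) _)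
        have h1 : ∀ i, 2 * (n:ℝ) * (√((a i : ℝ) / n) * √(x i) - a i / n)
            ≤ n * (x i - a i / n) - n / 4 * (x i - a i / n)^2 := by
          intro i
          set p := (a i : ℝ) / n
          have e1 := Real.sq_sqrt (hp0 i)
          have e2 := Real.sq_sqrt (hx i).le
          have b1 : √p ≤ 1 := Real.sqrt_le_one.2 (hp' i)
          have b2 : √(x i) ≤ 1 := Real.sqrt_le_one.2 (hx' i)
          have c1 := Real.sqrt_nonneg p
          have c2 := Real.sqrt_nonneg (x i)
          have h3 : (x i - p)^2 ≤ 4 * (√(x i) - √p)^2 := by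
            have : (x i - p)^2 = (√(x i) - √p)^2 * (√(x i) + √p)^2 := by
              rw [← mul_pow]
              have : (√(x i) - √p) * (√(x i) + √p) = √(x i)^2 - √p^2 := by ring
              rw [this, e1, e2]
            rw [this]
            have h4 : (√(x i) + √p)^2 ≤ 4 := by nlinarith
            nlinarith [sq_nonneg (√(x i) - √p)]
          have h5 : 2 * (√p * √(x i) - p) = (x i - p) - (√(x i) - √p)^2 := by
            have : (√(x i) - √p)^2 = √(x i)^2 + √p^2 - 2 * (√p * √(x i)) := by ring
            rw [this, e1, e2]; ring
          have h6 : 2 * (√p * √(x i) - p) ≤ (x i - p) - (x i - p)^2 / 4 := by linarith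
          calc 2 * (n:ℝ) * (√p * √(x i) - p) = n * (2 * (√p * √(x i) - p)) := by ring
            _ ≤ n * ((x i - p) - (x i - p)^2 / 4) := mul_le_mul_of_nonneg_left h6 hn0.le
            _ = _ := by ring
        refine (Finset.sum_le_sum fun i _ => h1 i).trans (le_of_eq ?_)
        rw [Finset.sum_sub_distrib, ← Finset.mul_sum, ← Finset.mul_sum, Finset.sum_sub_distrib,
          hx1, hp1]
        ring

lemma prod_lower {ι : Type*} [Fintype ι] (n : ℕ) (hn : 1 ≤ n) (a : ι → ℕ) (y : ι → ℝ) (m : ℝ)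
    (hm : 0 < m) (hy : ∀ i, m ≤ y i) (ha : ∑ i, a i = n) (hy1 : ∑ i, y i = 1) :
    (∏ i, ((a i : ℝ) / n) ^ a i) * Real.exp (-(n/m) * ∑ i, (y i - a i / n)^2) ≤ ∏ i, y i ^ a i := by
  have hn0 : (0:ℝ) < n := by exact_mod_cast hn
  have hp1 : ∑ i, ((a i : ℝ) / n) = 1 := by
    rw [← Finset.sum_div, ← Nat.cast_sum, ha, div_self hn0.ne']
  have key : ∀ i, ((a i : ℝ) / n) ^ a i *
      Real.exp (n * (y i - a i / n) - (n/m) * (y i - a i / n)^2) ≤ y i ^ a i := by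
    intro i
    have hyi : 0 < y i := hm.trans_le (hy i)
    set p := (a i : ℝ) / n with hp
    have hp0 : 0 ≤ p := by positivity
    have hanp : (a i : ℝ) = n * p := by rw [hp]; field_simp
    have h1 : p ≤ y i * Real.exp (p / y i - 1) := by
      have := Real.add_one_le_exp (p / y i - 1)
      have h2 := mul_le_mul_of_nonneg_left this hyi.le
      have e : y i * (p / y i - 1 + 1) = p := by field_simp; ring
      linarith
    have h2 := pow_le_pow_left₀ hp0 h1 (a i)
    rw [mul_pow, ← Real.exp_nat_mul] at h2
    calc _ ≤ (y i ^ a i * Real.exp (a i * (p / y i - 1))) *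
          Real.exp (n * (y i - p) - (n/m) * (y i - p)^2) :=
          mul_le_mul_of_nonneg_right h2 (Real.exp_pos _).le
      _ = y i ^ a i * Real.exp (a i * (p / y i - 1) + (n * (y i - p) - (n/m) * (y i - p)^2)) := by
          rw [mul_assoc, ← Real.exp_add]
      _ ≤ y i ^ a i * 1 := by
          refine mul_le_mul_of_nonneg_left ?_ (by positivity)
          rw [Real.exp_le_one_iff, hanp]
          have e : n * p * (p / y i - 1) + (n * (y i - p) - (n/m) * (y i - p)^2)
            = n * (y i - p)^2 * (1 / y i - 1 / m) := by field_simp; ring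
          rw [e]
          have : 1 / y i ≤ 1 / m := one_div_le_one_div_of_le hm (hy i)
          have h3 : 0 ≤ n * (y i - p)^2 := by positivity
          nlinarith
      _ = _ := mul_one _
  calc _ = ∏ i, (((a i : ℝ) / n) ^ a i *
      Real.exp (n * (y i - a i / n) - (n/m) * (y i - a i / n)^2)) := by
        rw [Finset.prod_mul_distrib, ← Real.exp_sum]
        congr 2
        rw [Finset.sum_sub_distrib, ← Finset.mul_sum, ← Finset.mul_sum, Finset.sum_sub_distrib,
          hy1, hp1]
        ring
    _ ≤ _ := Finset.prod_le_prod (fun i _ => by positivity) fun i _ => key i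

def extS {d : ℕ} (y : EuclideanSpace ℝ (Fin d)) : Fin (d+1) → ℝ :=
  Fin.snoc (α := fun _ => ℝ) (fun i => y i) (1 - ∑ i, y i)

lemma extS_castSucc {d : ℕ} (y : EuclideanSpace ℝ (Fin d)) (i : Fin d) :
    extS y i.castSucc = y i := by simp [extS]
lemma extS_last {d : ℕ} (y : EuclideanSpace ℝ (Fin d)) :
    extS y (Fin.last d) = 1 - ∑ i, y i := by simp [extS]
lemma extS_sum {d : ℕ} (y : EuclideanSpace ℝ (Fin d)) : ∑ i, extS y i = 1 := by
  rw [Fin.sum_univ_castSucc]; simp [extS_castSucc, extS_last]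

lemma extS_simplex {d : ℕ} {y : EuclideanSpace ℝ (Fin d)} (h : ∀ i, 0 ≤ extS y i) :
    y ∈ simplexT d := by
  refine ⟨fun i => by simpa [extS_castSucc] using h i.castSucc, ?_⟩
  have := h (Fin.last d); rw [extS_last] at this; linarith

lemma bern_eq {d : ℕ} (n : ℕ) (α : Fin d → ℕ) (y : EuclideanSpace ℝ (Fin d)) :
    bernsteinB n α y = ((n.factorial : ℝ) / ((∏ i, (α i).factorial : ℕ) * (n - ∑ i, α i).factorial)) *
     ∏ i, extS y i ^ (Fin.snoc (α := fun _ => ℕ) α (n - ∑ i, α i) : Fin (d+1) → ℕ) i := by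
  rw [Fin.prod_univ_castSucc]
  simp [extS_castSucc, extS_last, bernsteinB, mul_assoc]

lemma WTJ_eq {d : ℕ} (κ : Fin (d+1) → ℝ) (y : EuclideanSpace ℝ (Fin d)) :
    WTJ κ y = ∏ i, extS y i ^ (κ i - 1/2) := by
  rw [Fin.prod_univ_castSucc]
  simp [extS_castSucc, extS_last, WTJ]

lemma bern_cont {d : ℕ} (n : ℕ) (α : Fin d → ℕ) : Continuous (bernsteinB (d := d) n α) := by
  unfold bernsteinB; fun_prop

lemma bern_bdd {d : ℕ} (n : ℕ) (α : Fin d → ℕ) : ∃ c, ∀ y ∈ simplexT d, ‖bernsteinB n α y‖ ≤ c := by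
  refine ⟨((n.factorial : ℝ) / ((∏ i, (α i).factorial : ℕ) * (n - ∑ i, α i).factorial)),
    fun y hy => ?_⟩
  rw [Real.norm_of_nonneg (bern_nonneg _ _ hy), bern_eq]
  have h0 : ∀ i, 0 ≤ extS y i := fun i => by
    refine Fin.lastCases ?_ (fun j => ?_) i
    · rw [extS_last]; linarith [hy.2]
    · rw [extS_castSucc]; exact hy.1 j
  refine mul_le_of_le_one_right (by positivity) (Finset.prod_le_one (fun i _ => pow_nonneg (h0 i) _)
    fun i _ => pow_le_one₀ (h0 i) ?_)
  rw [← extS_sum y]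
  exact Finset.single_le_sum (fun i _ => h0 i) (Finset.mem_univ i)

lemma bern_mul_int {d : ℕ} (n : ℕ) (α : Fin d → ℕ) {g : EuclideanSpace ℝ (Fin d) → ℝ}
    (hg : IntegrableOn g (simplexT d)) :
    IntegrableOn (fun y => bernsteinB n α y * g y) (simplexT d) := by
  obtain ⟨c, hc⟩ := bern_bdd (d := d) n α
  refine Integrable.bdd_mul (c := c) hg (bern_cont n α).aestronglyMeasurable ?_
  filter_upwards [ae_restrict_mem (simplex_meas d)] with y hy using hc y hy

lemma coef_alg (M P E1 E2 E3 ED w ρ s V : ℝ) (d : ℕ) (hM : M ≠ 0) (hP : P ≠ 0) (hE : E3 ≠ 0)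
    (hw : w ≠ 0) (hρ : ρ ≠ 0) (hs : s ≠ 0) (hV : V ≠ 0) (h : E1 = ED * E2 * E3) :
    (M * (P * E1)) / (M * (P * E3) * w * ((ρ / s)^d * V)) = ED / (w * ρ^d * V) * s^d * E2 := by
  rw [h, div_pow]
  field_simp

set_option maxHeartbeats 1000000 in
lemma coef_bound {d : ℕ} (hd : 1 ≤ d) (κ : Fin (d+1) → ℝ) (hκ : ∀ i, 0 < κ i)
    (x : EuclideanSpace ℝ (Fin d)) (hx0 : ∀ i, 0 < x i) (hx1 : ∑ i, x i < 1) :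
    ∃ C : ℝ, 0 < C ∧ ∀ n : ℕ, 1 ≤ n → ∀ α : Fin d → ℕ, ∑ i, α i ≤ n →
      0 < (∫ y in simplexT d, bernsteinB n α y * WTJ κ y) ∧
      bernsteinB n α x / (∫ y in simplexT d, bernsteinB n α y * WTJ κ y)
        ≤ C * (√n)^d * Real.exp (-(n/8) * ∑ i, (x i - α i / n)^2) := by
  have hxe : ∀ i, 0 < extS x i := fun i => by
    refine Fin.lastCases ?_ (fun j => ?_) i
    · rw [extS_last]; linarith
    · rw [extS_castSucc]; exact hx0 j
  obtain ⟨i0, hi0⟩ := Finite.exists_min (extS x)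
  set μ := extS x i0 with hμ
  have hμ0 : 0 < μ := hxe i0
  have hμ1 : μ ≤ 1 := by
    rw [← extS_sum x]; exact Finset.single_le_sum (fun i _ => (hxe i).le) (Finset.mem_univ i0)
  set η := μ / 64 with hη
  have hη0 : 0 < η := by positivity
  have hη1 : η ≤ 1 := by rw [hη]; linarith
  set m := η * μ / 2 with hm
  have hm0 : 0 < m := by positivity
  have hd0 : (0:ℝ) < d + 1 := by positivity
  set ρ := η * μ / (2 * (d + 1)) with hρ
  have hρ0 : 0 < ρ := by positivity
  set D := 2 * (d + 1) * ρ^2 / m with hD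
  set w := ∏ i, m ^ |κ i - 1/2| with hw
  have hw0 : 0 < w := Finset.prod_pos fun i _ => Real.rpow_pos_of_pos hm0 _
  set V := (volume (Metric.ball (0 : EuclideanSpace ℝ (Fin d)) 1)).toReal with hV
  have hV0 : 0 < V := ENNReal.toReal_pos (Metric.measure_ball_pos _ _ one_pos).ne'
    measure_ball_lt_top.ne
  refine ⟨Real.exp D / (w * ρ^d * V), by positivity, fun n hn α hα => ?_⟩
  have hn0 : (0:ℝ) < n := by exact_mod_cast hn
  have hs : 0 < √(n:ℝ) := Real.sqrt_pos.2 hn0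
  have hs1 : 1 ≤ √(n:ℝ) := Real.one_le_sqrt.2 (by exact_mod_cast hn)
  set M := ((n.factorial : ℝ) / ((∏ i, (α i).factorial : ℕ) * (n - ∑ i, α i).factorial)) with hM
  have hM0 : 0 < M := by
    have h1 : (0:ℝ) < (∏ i, (α i).factorial : ℕ) := by
      exact_mod_cast Finset.prod_pos fun i _ => Nat.factorial_pos _
    have h2 : (0:ℝ) < (n - ∑ i, α i).factorial := by exact_mod_cast Nat.factorial_pos _
    have h3 : (0:ℝ) < n.factorial := by exact_mod_cast Nat.factorial_pos _
    positivity
  set a : Fin (d+1) → ℕ := Fin.snoc (α := fun _ => ℕ) α (n - ∑ i, α i) with ha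
  have hasum : ∑ i, a i = n := by
    rw [Fin.sum_univ_castSucc]; simp only [ha, Fin.snoc_castSucc, Fin.snoc_last]; omega
  have hp1 : ∑ i, ((a i : ℝ) / n) = 1 := by
    rw [← Finset.sum_div, ← Nat.cast_sum, hasum, div_self hn0.ne']
  set P := ∏ i, ((a i : ℝ) / n) ^ a i with hP
  have hP0 : 0 < P := Finset.prod_pos fun i _ => by
    rcases Nat.eq_zero_or_pos (a i) with h | h
    · simp [h]
    · have : (0:ℝ) < a i := by exact_mod_cast h
      positivity
  set S := ∑ i, (extS x i - a i / n)^2 with hS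
  have hS' : ∑ i, (x i - α i / n)^2 ≤ S := by
    rw [hS, Fin.sum_univ_castSucc]
    simp only [ha, Fin.snoc_castSucc, Fin.snoc_last, extS_castSucc]
    linarith [sq_nonneg (extS x (Fin.last d) - ((n - ∑ i, α i : ℕ) : ℝ) / n)]
  have hS0 : 0 ≤ S := Finset.sum_nonneg fun i _ => sq_nonneg _
  have hup : bernsteinB n α x ≤ M * (P * Real.exp (-(n/4) * S)) := by
    rw [bern_eq]
    exact mul_le_mul_of_nonneg_left (prod_upper n hn a _ hxe hasum (extS_sum x)) hM0.le
  -- the ball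
  set q : EuclideanSpace ℝ (Fin d) := WithLp.toLp 2 (fun i => (1 - η) * (α i / n) + η * x i) with hq
  have hqe : ∀ i, extS q i = (1 - η) * (a i / n) + η * extS x i := by
    intro i
    refine Fin.lastCases ?_ (fun j => ?_) i
    · have h1 : ((a (Fin.last d) : ℝ)) / n = 1 - ∑ i : Fin d, (α i : ℝ) / n := by
        rw [Fin.sum_univ_castSucc] at hp1
        simp only [ha, Fin.snoc_castSucc] at hp1 ⊢
        linarith
      rw [h1, extS_last, extS_last]
      simp only [hq, Finset.sum_add_distrib, ← Finset.mul_sum]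
      ring
    · rw [extS_castSucc, extS_castSucc]; simp [hq, ha]
  set r := ρ / √n with hr
  have hr0 : 0 < r := by positivity
  have hball : ∀ y ∈ Metric.ball q r, ∑ i, (extS y i - extS q i)^2 ≤ (d + 1) * r^2 := by
    intro y hy
    rw [Metric.mem_ball, dist_eq_norm] at hy
    have h1 : ∑ i : Fin d, (y i - q i)^2 ≤ r^2 := by
      have := pow_le_pow_left₀ (norm_nonneg _) hy.le 2
      rw [EuclideanSpace.norm_sq_eq] at this
      simpa using this
    have h2 : (∑ i : Fin d, (y i - q i))^2 ≤ d * ∑ i : Fin d, (y i - q i)^2 := by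
      simpa using sq_sum_le_card_mul_sum_sq (s := (Finset.univ : Finset (Fin d)))
        (f := fun i => y i - q i)
    rw [Fin.sum_univ_castSucc]
    simp only [extS_castSucc, extS_last]
    have h3 : (1 - ∑ i, y i - (1 - ∑ i, q i))^2 = (∑ i : Fin d, (y i - q i))^2 := by
      rw [Finset.sum_sub_distrib]; ring
    rw [h3]
    have : (d:ℝ) * ∑ i : Fin d, (y i - q i)^2 ≤ d * r^2 :=
      mul_le_mul_of_nonneg_left h1 (Nat.cast_nonneg d)
    linarith
  have hge : ∀ y ∈ Metric.ball q r, ∀ i, m ≤ extS y i := by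
    intro y hy i
    have h1 : (extS y i - extS q i)^2 ≤ ((d + 1) * ρ)^2 := by
      have h2 := Finset.single_le_sum (f := fun i => (extS y i - extS q i)^2)
        (fun i _ => sq_nonneg _) (Finset.mem_univ i)
      have h3 := hball y hy
      have h4 : r ≤ ρ := div_le_self hρ0.le hs1
      have h5 : r^2 ≤ ρ^2 := pow_le_pow_left₀ hr0.le h4 2
      have h6 : ((d:ℝ) + 1) * r^2 ≤ (d+1) * ρ^2 := mul_le_mul_of_nonneg_left h5 hd0.le
      have h7 : ((d:ℝ) + 1) * ρ^2 ≤ ((d+1) * ρ)^2 := by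
        have : (0:ℝ) ≤ d := Nat.cast_nonneg d
        have : 0 ≤ ρ^2 := by positivity
        rw [mul_pow]; nlinarith
      linarith
    have h2 := (abs_le.1 (abs_le_of_sq_le_sq h1 (by positivity))).1
    have h3 : (d + 1) * ρ = m := by rw [hρ, hm]; field_simp
    rw [h3, hqe] at h2
    have h4 : η * μ ≤ η * extS x i := mul_le_mul_of_nonneg_left (hi0 i) hη0.le
    have h5 : 0 ≤ (1 - η) * ((a i : ℝ) / n) := mul_nonneg (by linarith) (by positivity)
    have h6 : η * μ = 2 * m := by rw [hm]; ring
    linarith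
  have hsub : Metric.ball q r ⊆ simplexT d := fun y hy =>
    extS_simplex fun i => hm0.le.trans (hge y hy i)
  have hBlow : ∀ y ∈ Metric.ball q r, M * (P * Real.exp (-(n/16) * S - D)) ≤ bernsteinB n α y := by
    intro y hy
    rw [bern_eq]
    refine mul_le_mul_of_nonneg_left (le_trans ?_
      (prod_lower n hn a _ m hm0 (hge y hy) hasum (extS_sum y))) hM0.le
    refine mul_le_mul_of_nonneg_left (Real.exp_le_exp.2 ?_) hP0.le
    have h1 : ∑ i, (extS y i - a i / n)^2 ≤ 2 * η^2 * S + 2 * ((d + 1) * r^2) := by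
      have : ∑ i, (extS y i - a i / n)^2
          ≤ ∑ i, (2 * η^2 * (extS x i - a i / n)^2 + 2 * (extS y i - extS q i)^2) := by
        refine Finset.sum_le_sum fun i _ => ?_
        rw [hqe]
        nlinarith [sq_nonneg (η * (extS x i - a i / n) -
          (extS y i - ((1 - η) * (a i / n) + η * extS x i)))]
      rw [Finset.sum_add_distrib, ← Finset.mul_sum, ← Finset.mul_sum] at this
      linarith [hball y hy]
    have hr2 : r^2 = ρ^2 / n := by rw [hr, div_pow, Real.sq_sqrt hn0.le]
    have h2 : (n:ℝ) / m * (2 * η^2 * S + 2 * ((d + 1) * r^2)) = n / 16 * S + D := by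
      rw [hr2, hD, hm, hη]; field_simp; ring
    have h3 := mul_le_mul_of_nonneg_left h1 (by positivity : 0 ≤ (n:ℝ) / m)
    rw [h2] at h3
    linarith
  have hWlow : ∀ y ∈ Metric.ball q r, w ≤ WTJ κ y := by
    intro y hy
    rw [WTJ_eq]
    refine Finset.prod_le_prod (fun i _ => (Real.rpow_pos_of_pos hm0 _).le) fun i _ => ?_
    have hyi := hge y hy i
    have hy0 : 0 < extS y i := hm0.trans_le hyi
    have hy1 : extS y i ≤ 1 := by
      rw [← extS_sum y]
      exact Finset.single_le_sum (fun i _ => hm0.le.trans (hge y hy i)) (Finset.mem_univ i)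
    calc m ^ |κ i - 1/2| ≤ extS y i ^ |κ i - 1/2| :=
          Real.rpow_le_rpow hm0.le hyi (abs_nonneg _)
      _ ≤ _ := Real.rpow_le_rpow_of_exponent_ge hy0 hy1 (le_abs_self _)
  have hIlow : M * (P * Real.exp (-(n/16) * S - D)) * w * (r^d * V) ≤
      ∫ y in simplexT d, bernsteinB n α y * WTJ κ y := by
    have hint := bern_mul_int n α (WTJ_int hd κ hκ)
    have hvol : volume.real (Metric.ball q r) = r^d * V := by
      rw [measureReal_def, Measure.addHaar_ball_of_pos _ _ hr0, ENNReal.toReal_mul,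
        ENNReal.toReal_ofReal (by positivity)]
      simp [hV]
    calc _ = ∫ y in Metric.ball q r, M * (P * Real.exp (-(n/16) * S - D)) * w := by
          rw [setIntegral_const, hvol, smul_eq_mul]; ring
      _ ≤ ∫ y in Metric.ball q r, bernsteinB n α y * WTJ κ y := by
          refine setIntegral_mono_on ?_ (hint.mono_set hsub) measurableSet_ball fun y hy => ?_
          · exact integrableOn_const measure_ball_lt_top.ne
          · exact mul_le_mul (hBlow y hy) (hWlow y hy) hw0.le (bern_nonneg _ _ (hsub hy))
      _ ≤ _ := by
          refine setIntegral_mono_set hint ?_ hsub.eventuallyLE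
          filter_upwards [ae_restrict_mem (simplex_meas d)] with y hy
          exact mul_nonneg (bern_nonneg _ _ hy) (WTJ_nonneg κ hy)
  have hlow0 : 0 < M * (P * Real.exp (-(n/16) * S - D)) * w * (r^d * V) := by positivity
  refine ⟨hlow0.trans_le hIlow, ?_⟩
  calc _ ≤ (M * (P * Real.exp (-(n/4) * S))) /
        (M * (P * Real.exp (-(n/16) * S - D)) * w * (r^d * V)) :=
        div_le_div₀ (by positivity) hup hlow0 hIlow
    _ = Real.exp D / (w * ρ^d * V) * (√n)^d * Real.exp (-(3*n/16) * S) := by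
        refine coef_alg M P _ _ _ _ w ρ _ V d hM0.ne' hP0.ne' (Real.exp_pos _).ne' hw0.ne' hρ0.ne'
          hs.ne' hV0.ne' ?_
        have e1 : Real.exp (-(n/4) * S) = Real.exp D * Real.exp (-(3*n/16) * S) *
            Real.exp (-(n/16) * S - D) := by
          rw [← Real.exp_add, ← Real.exp_add]; congr 1; ring
        exact e1
    _ ≤ _ := by
        refine mul_le_mul_of_nonneg_left (Real.exp_le_exp.2 ?_) (by positivity)
        have h1 : (n:ℝ) / 8 * ∑ i, (x i - α i / n)^2 ≤ n / 8 * S :=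
          mul_le_mul_of_nonneg_left hS' (by positivity)
        nlinarith [mul_nonneg hn0.le hS0]

/-- Lebesgue point lemma for Gaussian-type kernels. -/
lemma gauss_leb {d : ℕ} (h : EuclideanSpace ℝ (Fin d) → ℝ) (hi : Integrable h)
    (x : EuclideanSpace ℝ (Fin d)) (c : ℝ) (hc : 0 < c)
    (hL : Tendsto (fun r : ℝ => (∫ y in Metric.closedBall x r, |h y|) / r ^ d)
      (nhdsWithin 0 (Ioi 0)) (nhds 0)) :
    Tendsto (fun n : ℕ => ∫ y, |h y| * ((√n)^d * Real.exp (-c * n * ‖x - y‖^2))) atTop (nhds 0) := by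
  set H : ℝ → ℝ := fun r => ∫ y in Metric.closedBall x r, |h y| with hH
  have hH0 : ∀ r, 0 ≤ H r := fun r => integral_nonneg fun y => abs_nonneg _
  have hHle : ∀ r, H r ≤ ∫ y, |h y| := fun r =>
    setIntegral_le_integral hi.abs (Eventually.of_forall fun y => abs_nonneg _)
  set N := ∫ y, |h y| with hN
  have hN0 : 0 ≤ N := integral_nonneg fun y => abs_nonneg _
  -- uniform bound
  obtain ⟨A, hA0, hA⟩ : ∃ A, 0 ≤ A ∧ ∀ r, 0 < r → H r / r ^ d ≤ A := by
    have h1 : ∀ᶠ r in nhdsWithin (0:ℝ) (Ioi 0), H r / r ^ d < 1 :=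
      hL.eventually (gt_mem_nhds one_pos)
    rw [eventually_nhdsWithin_iff, Metric.eventually_nhds_iff] at h1
    obtain ⟨δ, hδ, h1⟩ := h1
    refine ⟨1 + N / δ ^ d, by positivity, fun r hr => ?_⟩
    by_cases hrd : r < δ
    · have := h1 (y := r) (by simpa [abs_of_pos hr] using hrd) hr
      have : 0 ≤ N / δ ^ d := by positivity
      linarith
    · push Not at hrd
      have : H r / r ^ d ≤ N / δ ^ d :=
        div_le_div₀ hN0 (hHle r) (by positivity) (pow_le_pow_left₀ hδ.le hrd d)
      linarith
  set F : ℕ → ℕ → ℝ := fun n k => (Real.exp (-c * k^2) * ((k:ℝ)+1)^d) *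
    (H (((k:ℝ)+1) / √n) / (((k:ℝ)+1) / √n) ^ d) with hF
  have hsum : Summable (fun k : ℕ => Real.exp (-c * k^2) * ((k:ℝ)+1)^d) := by
    have h0 : Summable (fun k : ℕ => (((k + 1 : ℕ) : ℝ))^d * Real.exp (-c * ((k + 1 : ℕ) : ℝ))) :=
      (summable_nat_add_iff 1).2 (Real.summable_pow_mul_exp_neg_nat_mul d hc)
    refine Summable.of_nonneg_of_le (fun k => by positivity) (fun k => ?_)
      (h0.mul_left (Real.exp c))
    have : (k:ℝ) ≤ (k:ℝ)^2 := by
      exact_mod_cast Nat.le_self_pow two_ne_zero k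
    calc Real.exp (-c * k^2) * ((k:ℝ)+1)^d ≤ Real.exp (-c * k) * ((k:ℝ)+1)^d := by
          refine mul_le_mul_of_nonneg_right (Real.exp_le_exp.2 (by nlinarith)) (by positivity)
      _ = _ := by
          have : Real.exp (-c * (k:ℝ)) = Real.exp c * Real.exp (-c * ((k + 1 : ℕ) : ℝ)) := by
            rw [← Real.exp_add]; congr 1; push_cast; ring
          rw [this]; push_cast; ring
  have hT : Tendsto (fun n => ∑' k, F n k) atTop (nhds (∑' k : ℕ, (0:ℝ))) := by
    refine tendsto_tsum_of_dominated_convergence (hsum.mul_right A) (fun k => ?_) ?_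
    · have hk : Tendsto (fun n : ℕ => ((k:ℝ)+1) / √n) atTop (nhdsWithin 0 (Ioi 0)) := by
        refine tendsto_nhdsWithin_iff.2 ⟨?_, ?_⟩
        · exact tendsto_const_nhds.div_atTop
            (Real.tendsto_sqrt_atTop.comp tendsto_natCast_atTop_atTop)
        · filter_upwards [eventually_ge_atTop 1] with n hn
          have : (0:ℝ) < n := by exact_mod_cast hn
          have : 0 < √(n:ℝ) := Real.sqrt_pos.2 this
          simp only [mem_Ioi]; positivity
      have := (hL.comp hk).const_mul (Real.exp (-c * k^2) * ((k:ℝ)+1)^d)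
      simpa [hF] using this
    · filter_upwards [eventually_ge_atTop 1] with n hn k
      have : (0:ℝ) < n := by exact_mod_cast hn
      have hs : 0 < √(n:ℝ) := Real.sqrt_pos.2 this
      have hr : 0 < ((k:ℝ)+1) / √n := by positivity
      have h0 := hH0 (((k:ℝ)+1) / √n)
      rw [Real.norm_of_nonneg (by positivity)]
      exact mul_le_mul_of_nonneg_left (hA _ hr) (by positivity)
  rw [tsum_zero] at hT
  refine tendsto_of_tendsto_of_tendsto_of_le_of_le' tendsto_const_nhds hT ?_ ?_
  · exact Eventually.of_forall fun n => integral_nonneg fun y => by positivity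
  filter_upwards [eventually_ge_atTop 1] with n hn
  have hn0 : (0:ℝ) < n := by exact_mod_cast hn
  have hs : 0 < √(n:ℝ) := Real.sqrt_pos.2 hn0
  set G : ℕ → EuclideanSpace ℝ (Fin d) → ℝ := fun k =>
    indicator (Metric.closedBall x (((k:ℝ)+1) / √n))
      (fun y => (√n)^d * Real.exp (-c * k^2) * |h y|) with hG
  have hG0 : ∀ k y, 0 ≤ G k y := fun k y =>
    Set.indicator_nonneg (fun y _ => by positivity) y
  have hGi : ∀ k, Integrable (G k) := fun k =>
    (hi.abs.const_mul _).indicator Metric.isClosed_closedBall.measurableSet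
  have hGint : ∀ k, ∫ y, G k y = F n k := by
    intro k
    simp only [hG, hF]
    rw [integral_indicator Metric.isClosed_closedBall.measurableSet, integral_const_mul]
    simp only [hH]
    rw [div_pow]
    field_simp
  have hFs : Summable (F n) := by
    refine Summable.of_nonneg_of_le (fun k => ?_) (fun k => ?_) (hsum.mul_right A)
    · have h0 := hH0 (((k:ℝ)+1) / √n)
      positivity
    · exact mul_le_mul_of_nonneg_left (hA _ (by positivity)) (by positivity)
  have hGs := hasSum_integral_of_summable_integral_norm hGi (by
    refine hFs.congr fun k => ?_
    rw [← hGint k]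
    exact integral_congr_ae (Eventually.of_forall fun y => (Real.norm_of_nonneg (hG0 k y)).symm))
  have hGs' : ∑' k, F n k = ∫ y, ∑' k, G k y := by
    rw [← hGs.tsum_eq]; exact tsum_congr fun k => (hGint k).symm
  rw [hGs']
  have hsG : ∀ y, Summable (fun k => G k y) := by
    intro y
    have : Summable (fun k : ℕ => (Real.exp (-c * k^2) * ((k:ℝ)+1)^d) * ((√n)^d * |h y|)) :=
      hsum.mul_right _
    refine Summable.of_nonneg_of_le (fun k => hG0 k y) (fun k => ?_) this
    refine Set.indicator_apply_le' (fun _ => ?_) (fun _ => by positivity)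
    have h1 : (1:ℝ) ≤ ((k:ℝ)+1)^d := one_le_pow₀ (by linarith [(Nat.cast_nonneg k : (0:ℝ) ≤ k)])
    have h2 : 0 ≤ Real.exp (-c * (k:ℝ)^2) * ((√n)^d * |h y|) := by positivity
    nlinarith
  have hint : Integrable (fun y => ∑' k, G k y) := by
    have hm : AEStronglyMeasurable (fun y => ∑' k, G k y) volume := by
      refine aestronglyMeasurable_of_tendsto_ae atTop
        (f := fun (m : ℕ) y => ∑ k ∈ Finset.range m, G k y) (fun m => ?_) ?_
      · exact (integrable_finsetSum _ fun k _ => hGi k).aestronglyMeasurable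
      · exact Eventually.of_forall fun y => (hsG y).hasSum.tendsto_sum_nat
    refine Integrable.mono' (hi.abs.const_mul
      (∑' k : ℕ, (Real.exp (-c * k^2) * ((k:ℝ)+1)^d) * (√n)^d)) hm ?_
    refine Eventually.of_forall fun y => ?_
    rw [Real.norm_of_nonneg (tsum_nonneg fun k => hG0 k y), ← tsum_mul_right]
    refine (hsG y).tsum_le_tsum (fun k => ?_) ((hsum.mul_right _).mul_right _)
    refine Set.indicator_apply_le' (fun _ => ?_) (fun _ => by positivity)
    have h1 : (1:ℝ) ≤ ((k:ℝ)+1)^d := one_le_pow₀ (by linarith [(Nat.cast_nonneg k : (0:ℝ) ≤ k)])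
    have h2 : 0 ≤ Real.exp (-c * (k:ℝ)^2) * ((√n)^d * |h y|) := by positivity
    nlinarith
  refine integral_mono_of_nonneg (Eventually.of_forall fun y => by positivity) hint ?_
  refine Eventually.of_forall fun y => ?_
  set k := ⌊√n * ‖x - y‖⌋₊ with hk
  have hk1 : (k:ℝ) ≤ √n * ‖x - y‖ := Nat.floor_le (by positivity)
  have hk2 : √n * ‖x - y‖ < k + 1 := Nat.lt_floor_add_one _
  refine le_trans ?_ ((hsG y).le_tsum k (fun j _ => hG0 j y))
  have hmem : y ∈ Metric.closedBall x (((k:ℝ)+1) / √n) := by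
    rw [Metric.mem_closedBall, dist_comm, dist_eq_norm, le_div_iff₀ hs]; linarith
  simp only [hG]
  rw [Set.indicator_of_mem hmem]
  have : Real.exp (-c * n * ‖x - y‖^2) ≤ Real.exp (-c * k^2) := by
    apply Real.exp_le_exp.2
    have e : (n:ℝ) * ‖x - y‖^2 = (√n * ‖x - y‖)^2 := by
      rw [mul_pow, Real.sq_sqrt hn0.le]
    have : (k:ℝ)^2 ≤ n * ‖x - y‖^2 := by
      rw [e]; exact pow_le_pow_left₀ (by positivity) hk1 2
    nlinarith
  calc |h y| * ((√n)^d * Real.exp (-c * n * ‖x - y‖^2))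
      ≤ |h y| * ((√n)^d * Real.exp (-c * k^2)) := by gcongr
    _ = _ := by ring

lemma bd_bound {d : ℕ} (hd : 1 ≤ d) (κ : Fin (d+1) → ℝ) (hκ : ∀ i, 0 < κ i)
    (f : EuclideanSpace ℝ (Fin d) → ℝ)
    (hf : IntegrableOn (fun x => f x * WTJ κ x) (simplexT d) volume)
    (x : EuclideanSpace ℝ (Fin d)) (hx0 : ∀ i, 0 < x i) (hx1 : ∑ i, x i < 1) :
    ∃ C : ℝ, 0 < C ∧ ∀ n : ℕ, 1 ≤ n →
      |bernsteinDurrmeyer d κ f n x - f x| ≤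
        C * ∫ y in simplexT d, |f y * WTJ κ y - f x * WTJ κ y| *
          ((√n)^d * Real.exp (-(1 / (16 * d)) * n * ‖x - y‖^2)) := by
  have hxT : x ∈ simplexT d := ⟨fun i => (hx0 i).le, hx1.le⟩
  obtain ⟨C, hC, hcoef⟩ := coef_bound hd κ hκ x hx0 hx1
  refine ⟨C, hC, fun n hn => ?_⟩
  have hW := WTJ_int hd κ hκ
  set g : EuclideanSpace ℝ (Fin d) → ℝ := fun y => f y * WTJ κ y - f x * WTJ κ y with hg
  have hgi : IntegrableOn g (simplexT d) := hf.sub (hW.const_mul _)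
  set B : (Fin d → Fin (n+1)) → EuclideanSpace ℝ (Fin d) → ℝ :=
    fun β => bernsteinB n (fun i => (β i : ℕ)) with hB
  set I : (Fin d → Fin (n+1)) → ℝ := fun β => ∫ y in simplexT d, B β y * WTJ κ y with hI
  have hI0 : ∀ β : Fin d → Fin (n+1), ∑ i, (β i : ℕ) ≤ n → 0 < I β := fun β hβ =>
    (hcoef n hn _ hβ).1
  have hcb : ∀ β : Fin d → Fin (n+1), ∑ i, (β i : ℕ) ≤ n →
      B β x / I β ≤ C * (√n)^d * Real.exp (-(n/8) * ∑ i, (x i - (β i : ℕ) / n)^2) := fun β hβ =>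
    (hcoef n hn _ hβ).2
  have hBx : ∀ β, 0 ≤ B β x := fun β => bern_nonneg _ _ hxT
  have step1 : bernsteinDurrmeyer d κ f n x - f x =
      ∑ β : Fin d → Fin (n+1), if ∑ i, (β i : ℕ) ≤ n then
        (B β x / I β) * ∫ y in simplexT d, B β y * g y else 0 := by
    have h1 : f x = ∑ β : Fin d → Fin (n+1), if ∑ i, (β i : ℕ) ≤ n then f x * B β x else 0 := by
      have := bern_sum n x
      have h2 := congrArg (fun t => f x * t) this
      simp only [Finset.mul_sum, mul_ite, mul_zero, mul_one] at h2
      exact h2.symm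
    conv_lhs => rw [h1]
    unfold bernsteinDurrmeyer
    rw [← Finset.sum_sub_distrib]
    refine Finset.sum_congr rfl fun β _ => ?_
    split_ifs with hβ
    · have e : ∫ y in simplexT d, B β y * g y =
          (∫ y in simplexT d, f y * B β y * WTJ κ y) - f x * I β := by
        rw [hI]
        simp only
        rw [← integral_const_mul, ← integral_sub]
        · refine integral_congr_ae (Eventually.of_forall fun y => ?_)
          simp only [hg]; ring
        · refine (bern_mul_int n (fun i => (β i : ℕ)) hf).congr (Eventually.of_forall fun y => ?_)
          simp only [hB]; ring
        · exact (bern_mul_int n (fun i => (β i : ℕ)) hW).const_mul _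
      rw [e]
      have := (hI0 β hβ).ne'
      change (∫ y in simplexT d, f y * B β y * WTJ κ y) / I β * B β x - f x * B β x = _
      field_simp
    · simp
  have step2 : |bernsteinDurrmeyer d κ f n x - f x| ≤
      ∑ β : Fin d → Fin (n+1), if ∑ i, (β i : ℕ) ≤ n then
        (B β x / I β) * ∫ y in simplexT d, B β y * |g y| else 0 := by
    rw [step1]
    refine (Finset.abs_sum_le_sum_abs _ _).trans (Finset.sum_le_sum fun β _ => ?_)
    split_ifs with hβ
    · have h0 : 0 ≤ B β x / I β := div_nonneg (hBx β) (hI0 β hβ).le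
      rw [abs_mul, abs_of_nonneg h0]
      refine mul_le_mul_of_nonneg_left ?_ h0
      refine abs_integral_le_integral_abs.trans (le_of_eq ?_)
      refine setIntegral_congr_fun (simplex_meas d) fun y hy => ?_
      simp only [abs_mul]
      rw [abs_of_nonneg (bern_nonneg _ _ hy)]
    · simp
  refine step2.trans ?_
  have hgabs : IntegrableOn (fun y => |g y|) (simplexT d) := hgi.abs
  have step3 : (∑ β : Fin d → Fin (n+1), if ∑ i, (β i : ℕ) ≤ n then
        (B β x / I β) * ∫ y in simplexT d, B β y * |g y| else 0) =
      ∫ y in simplexT d, ∑ β : Fin d → Fin (n+1), if ∑ i, (β i : ℕ) ≤ n then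
        (B β x / I β) * (B β y * |g y|) else 0 := by
    rw [integral_finsetSum]
    · refine Finset.sum_congr rfl fun β _ => ?_
      split_ifs
      · rw [integral_const_mul]
      · simp
    · intro β _
      split_ifs
      · exact (bern_mul_int n (fun i => (β i : ℕ)) hgabs).const_mul _
      · exact integrable_zero _ _ _
  rw [step3, ← integral_const_mul]
  refine setIntegral_mono_on ?_ ?_ (simplex_meas d) fun y hy => ?_
  · refine integrable_finsetSum _ fun β _ => ?_
    split_ifs
    · exact (bern_mul_int n (fun i => (β i : ℕ)) hgabs).const_mul _
    · exact integrable_zero _ _ _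
  · refine Integrable.const_mul ?_ _
    refine Integrable.mul_bdd (c := (√n)^d) hgabs ?_ (Eventually.of_forall fun y => ?_)
    · refine Continuous.aestronglyMeasurable ?_
      fun_prop
    · rw [Real.norm_of_nonneg (by positivity)]
      refine mul_le_of_le_one_right (by positivity) (Real.exp_le_one_iff.2 ?_)
      have : 0 ≤ (1 / (16 * (d:ℝ))) * n * ‖x - y‖^2 := by positivity
      linarith
  · have hk := kernel_tail n hn hxT hy hd
    calc _ ≤ ∑ β : Fin d → Fin (n+1), (C * (√n)^d * |g y|) * (if ∑ i, (β i : ℕ) ≤ n then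
          Real.exp (-(n / 8) * ∑ i, (x i - (β i : ℕ) / n)^2) * B β y else 0) := by
          refine Finset.sum_le_sum fun β _ => ?_
          split_ifs with hβ
          · have h1 := mul_le_mul_of_nonneg_right (hcb β hβ)
              (mul_nonneg (bern_nonneg n (fun i => (β i : ℕ)) hy) (abs_nonneg (g y)))
            refine h1.trans (le_of_eq ?_)
            ring
          · simp
      _ ≤ (C * (√n)^d * |g y|) * Real.exp (-(1 / (16 * d)) * n * ‖x - y‖^2) := by
          rw [← Finset.mul_sum]
          exact mul_le_mul_of_nonneg_left hk (by positivity)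
      _ = _ := by ring

lemma leb_pt {d : ℕ} (g : EuclideanSpace ℝ (Fin d) → ℝ) (hg : Integrable g) :
    ∀ᵐ x, Tendsto (fun r : ℝ => (∫ y in Metric.closedBall x r, |g y - g x|) / r ^ d)
      (nhdsWithin 0 (Ioi 0)) (nhds 0) := by
  have h := IsUnifLocDoublingMeasure.ae_tendsto_average_norm_sub
    (volume : Measure (EuclideanSpace ℝ (Fin d))) hg.locallyIntegrable 1
  set V := (volume (Metric.ball (0 : EuclideanSpace ℝ (Fin d)) 1)).toReal with hV
  have hV0 : 0 < V := ENNReal.toReal_pos (Metric.measure_ball_pos _ _ one_pos).ne'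
    measure_ball_lt_top.ne
  filter_upwards [h] with x hx
  have h1 := hx (l := nhdsWithin (0:ℝ) (Ioi 0)) (fun _ => x) id tendsto_id (by
    filter_upwards [self_mem_nhdsWithin] with r hr
    simp only [id, one_mul]
    exact Metric.mem_closedBall_self (le_of_lt hr))
  have h2 := h1.mul_const V
  rw [zero_mul] at h2
  refine h2.congr' ?_
  filter_upwards [self_mem_nhdsWithin] with r hr
  have hr0 : (0:ℝ) < r := hr
  rw [setAverage_eq, measureReal_def, id, Measure.addHaar_closedBall _ _ hr0.le, ENNReal.toReal_mul,
        ENNReal.toReal_ofReal (by positivity), ← hV]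
  simp only [smul_eq_mul, Real.norm_eq_abs, finrank_euclideanSpace, Fintype.card_fin]
  field_simp

theorem statement19 (d : ℕ) (hd : 1 ≤ d) (κ : Fin (d+1) → ℝ) (hκ : ∀ i, 0 < κ i)
    (f : EuclideanSpace ℝ (Fin d) → ℝ)
    (hf : IntegrableOn (fun x => f x * WTJ κ x) (simplexT d) volume) :
    ∀ᵐ x ∂(volume.restrict (simplexT d)),
      Tendsto (fun n : ℕ => bernsteinDurrmeyer d κ f n x) atTop (nhds (f x)) := by
  have hW := WTJ_int hd κ hκ
  have hT := simplex_meas d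
  set g1 := indicator (simplexT d) (fun x => f x * WTJ κ x) with hg1
  set g2 := indicator (simplexT d) (WTJ κ) with hg2
  have i1 : Integrable g1 := (integrable_indicator_iff hT).2 hf
  have i2 : Integrable g2 := (integrable_indicator_iff hT).2 hW
  filter_upwards [ae_pos d hd, ae_restrict_mem hT, ae_restrict_of_ae (leb_pt g1 i1),
    ae_restrict_of_ae (leb_pt g2 i2)] with x hx hxT hl1 hl2
  obtain ⟨C, hC, hb⟩ := bd_bound hd κ hκ f hf x hx.1 hx.2
  set h : EuclideanSpace ℝ (Fin d) → ℝ := fun y => g1 y - f x * g2 y with hh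
  have hi : Integrable h := i1.sub (i2.const_mul _)
  have hx12 : g1 x = f x * g2 x := by
    simp only [hg1, hg2, Set.indicator_of_mem hxT]
  have hL : Tendsto (fun r : ℝ => (∫ y in Metric.closedBall x r, |h y|) / r ^ d)
      (nhdsWithin 0 (Ioi 0)) (nhds 0) := by
    have h3 := hl1.add (hl2.const_mul |f x|)
    rw [mul_zero, add_zero] at h3
    refine tendsto_of_tendsto_of_tendsto_of_le_of_le' tendsto_const_nhds h3 ?_ ?_
    · filter_upwards [self_mem_nhdsWithin] with r hr
      have hr0 : (0:ℝ) < r := hr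
      exact div_nonneg (integral_nonneg fun y => abs_nonneg _) (by positivity)
    · filter_upwards [self_mem_nhdsWithin] with r hr
      have hr0 : (0:ℝ) < r := hr
      rw [← mul_div_assoc, ← add_div]
      refine div_le_div_of_nonneg_right ?_ (by positivity)
      have hc : ∀ c : ℝ, IntegrableOn (fun _ => c) (Metric.closedBall x r) := fun c =>
        integrableOn_const measure_closedBall_lt_top.ne
      have j1 : IntegrableOn (fun y => |g1 y - g1 x|) (Metric.closedBall x r) :=
        (i1.integrableOn.sub (hc _)).abs
      have j2 : IntegrableOn (fun y => |g2 y - g2 x|) (Metric.closedBall x r) :=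
        (i2.integrableOn.sub (hc _)).abs
      rw [← integral_const_mul, ← integral_add j1 (j2.const_mul _)]
      refine integral_mono hi.abs.integrableOn (j1.add (j2.const_mul _)) fun y => ?_
      simp only [hh, Pi.add_apply]
      have e : g1 y - f x * g2 y = (g1 y - g1 x) - f x * (g2 y - g2 x) := by rw [hx12]; ring
      rw [e, ← abs_mul]
      exact abs_sub _ _
  have hd0 : (0:ℝ) < d := by exact_mod_cast hd
  have hG := (gauss_leb h hi x (1 / (16 * d)) (by positivity) hL).const_mul C
  rw [mul_zero] at hG
  rw [tendsto_iff_norm_sub_tendsto_zero]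
  refine tendsto_of_tendsto_of_tendsto_of_le_of_le' tendsto_const_nhds hG
    (Eventually.of_forall fun n => norm_nonneg _) ?_
  filter_upwards [eventually_ge_atTop 1] with n hn
  rw [Real.norm_eq_abs]
  refine (hb n hn).trans (le_of_eq ?_)
  congr 1
  rw [← integral_indicator hT]
  refine integral_congr_ae (Eventually.of_forall fun y => ?_)
  by_cases hy : y ∈ simplexT d
  · simp only [hh, hg1, hg2, Set.indicator_of_mem hy]
  · simp only [hh, hg1, hg2, Set.indicator_of_notMem hy]; simp
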